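/- Let δ > 0 and 0 ≤ ω ≤ δ be reals with x = ω/δ, let N ≥ 3 be an integer, let E ≥ 0 and E_1 ≥ E_2 ≥ ⋯ ≥ E_{N−1} > 0 be real numbers satisfying E^δ ≤ ∑_{i=1}^{N−1} E_i^δ, and for p = 2, …, N−1 set τ_p = (E_1^δ + ⋯ + E_{p−1}^δ)/E_p^δ. Then the following chain of inequalities holds: E^ω ≤ E_1^ω + ∑_{k=2}^{N−1} (k^x − (k−1)^x)·E_k^ω + x·∑_{p=2}^{N−1} ((p−1)²/p²)·(τ_p^(x−1) − (p−1)^(x−1))·E_p^ω ≤ E_1^ω + ∑_{k=2}^{N−1} (k^x − (k−1)^x)·E_k^ω ≤ E_1^ω + ∑_{k=2}^{N−1} (2^x − 1)·E_k^ω ≤ E_1^ω + ∑_{k=2}^{N−1} x·E_k^ω ≤ ∑_{k=1}^{N−1} E_k^ω. -/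

import Mathlib

open Real Finset

/-- For `0 ≤ x ≤ 1` and `0 ≤ c ≤ m / (m + 1)`, the function
`t ↦ (1 + t) ^ x - t ^ x - x * c * t ^ (x - 1)` is nonincreasing on `[m, ∞)`. -/
theorem antitoneOn_one_add_rpow_sub {x c m : ℝ} (hx0 : 0 ≤ x) (hx1 : x ≤ 1) (hm : 0 < m)
    (hcm : c ≤ m / (m + 1)) :
    AntitoneOn (fun t : ℝ => (1 + t) ^ x - t ^ x - x * c * t ^ (x - 1)) (Set.Ici m) := by
  have hd : ∀ t : ℝ, 0 < t → HasDerivAt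
      (fun t : ℝ => (1 + t) ^ x - t ^ x - x * c * t ^ (x - 1))
      (1 * x * (1 + t) ^ (x - 1) - x * t ^ (x - 1) -
        x * c * ((x - 1) * t ^ (x - 1 - 1))) t := by
    intro t ht
    exact ((((hasDerivAt_id t).const_add 1).rpow_const (Or.inl (by simp; linarith))).sub
      (hasDerivAt_rpow_const (Or.inl ht.ne'))).sub
      ((hasDerivAt_rpow_const (Or.inl ht.ne')).const_mul (x * c))
  apply antitoneOn_of_deriv_nonpos (convex_Ici m)
  · intro t ht
    exact (hd t (hm.trans_le ht)).continuousAt.continuousWithinAt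
  · intro t ht
    rw [interior_Ici] at ht
    exact (hd t (hm.trans ht)).differentiableAt.differentiableWithinAt
  · intro t ht
    rw [interior_Ici] at ht
    have hmt : m < t := ht
    have ht0 : 0 < t := hm.trans ht
    rw [(hd t ht0).deriv]
    have hct : c ≤ t / (1 + t) := by
      refine hcm.trans ?_
      rw [div_le_div_iff₀ (by linarith) (by linarith)]
      nlinarith
    have hb : (t / (1 + t)) ^ (1 - x) ≤ 1 - (1 - x) / (1 + t) := by
      have h := rpow_one_add_le_one_add_mul_self (s := -(1 / (1 + t))) (p := 1 - x)
        (by rw [neg_le_neg_iff, div_le_one (by linarith)]; linarith) (by linarith) (by linarith)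
      have e : 1 + -(1 / (1 + t)) = t / (1 + t) := by field_simp; ring
      rw [e] at h
      refine h.trans (le_of_eq ?_)
      ring
    have e1 : (1 + t) ^ (x - 1) = t ^ (x - 1) * (t / (1 + t)) ^ (1 - x) := by
      rw [div_rpow ht0.le (by linarith), ← mul_div_assoc, ← rpow_add ht0,
        show x - 1 + (1 - x) = 0 by ring, rpow_zero, one_div, ← rpow_neg (by linarith), neg_sub]
    have e2 : t ^ (x - 1 - 1) = t ^ (x - 1) / t := rpow_sub_one ht0.ne' _
    have hP : 0 ≤ x * t ^ (x - 1) := by positivity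
    have hc' : c * (1 - x) / t ≤ (1 - x) / (1 + t) := by
      have := mul_le_mul_of_nonneg_right hct (div_nonneg (sub_nonneg.2 hx1) ht0.le)
      calc c * (1 - x) / t = c * ((1 - x) / t) := by ring
        _ ≤ _ := this
        _ = _ := by field_simp
    rw [e1, e2]
    calc _ = x * t ^ (x - 1) * ((t / (1 + t)) ^ (1 - x) - 1 + c * (1 - x) / t) := by ring
      _ ≤ 0 := mul_nonpos_of_nonneg_of_nonpos hP (by linarith)

theorem rpow_add_le_rpow_add_correction {x m A B : ℝ} (hx0 : 0 ≤ x) (hx1 : x ≤ 1)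
    (hm : 0 < m) (hB : 0 < B) (hmA : m ≤ A / B) :
    (A + B) ^ x ≤ A ^ x + ((m + 1) ^ x - m ^ x) * B ^ x +
      x * (m ^ 2 / (m + 1) ^ 2 * ((A / B) ^ (x - 1) - m ^ (x - 1)) * B ^ x) := by
  have hc : m ^ 2 / (m + 1) ^ 2 ≤ m / (m + 1) := by
    rw [div_le_div_iff₀ (by positivity) (by positivity)]
    nlinarith [mul_pos hm (show 0 < m + 1 by linarith)]
  have h := antitoneOn_one_add_rpow_sub hx0 hx1 hm hc (Set.mem_Ici.2 le_rfl)
    (Set.mem_Ici.2 hmA) hmA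
  set t := A / B
  have ht : 0 ≤ t := hm.le.trans hmA
  have hA : A = t * B := (div_mul_cancel₀ A hB.ne').symm
  have e1 : A ^ x = t ^ x * B ^ x := by rw [hA, mul_rpow ht hB.le]
  have e2 : (A + B) ^ x = (1 + t) ^ x * B ^ x := by
    rw [hA, ← mul_rpow (by linarith) hB.le]
    ring_nf
  have h' := mul_le_mul_of_nonneg_right h (rpow_nonneg hB.le x)
  rw [e1, e2, add_comm m 1] at *
  linarith

/-- Increments of `t ↦ t ^ x` over unit intervals are at most the increment over `[1, 2]`. -/
theorem rpow_sub_rpow_sub_one_le {x y : ℝ} (hx0 : 0 ≤ x) (hx1 : x ≤ 1) (hy : 2 ≤ y) :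
    y ^ x - (y - 1) ^ x ≤ 2 ^ x - 1 := by
  have h := antitoneOn_one_add_rpow_sub (c := 0) hx0 hx1 one_pos (by norm_num)
    (Set.mem_Ici.2 le_rfl) (Set.mem_Ici.2 (show 1 ≤ y - 1 by linarith)) (by linarith)
  norm_num at h
  linarith

theorem natCast_le_sum_div_of_antitone {a : ℕ → ℝ} {M n : ℕ} (hpos : ∀ i, 1 ≤ i → i ≤ M → 0 < a i)
    (hanti : ∀ i, 1 ≤ i → i < M → a (i + 1) ≤ a i) (hn : n + 1 ≤ M) :
    (n : ℝ) ≤ (∑ i ∈ Icc 1 n, a i) / a (n + 1) := by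
  rw [le_div_iff₀ (hpos _ (by omega) hn)]
  have hle : ∀ i ∈ Icc 1 n, a (n + 1) ≤ a i := by
    intro i hi
    rw [mem_Icc] at hi
    have : ∀ j, i ≤ j → j ≤ M → a j ≤ a i := by
      intro j hij
      induction j, hij using Nat.le_induction with
      | base => intro _; exact le_rfl
      | succ j hij ih =>
        intro hj
        exact (hanti j (by omega) (by omega)).trans (ih (by omega))
    exact this _ (by omega) hn
  simpa using card_nsmul_le_sum _ _ _ hle

/-- Iterated bound on the `x`-th power of a sum of a nonincreasing positive sequence. -/
theorem sum_rpow_le_sum_correction {a : ℕ → ℝ} {M : ℕ} {x : ℝ} (hx0 : 0 ≤ x) (hx1 : x ≤ 1)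
    (hpos : ∀ i, 1 ≤ i → i ≤ M → 0 < a i)
    (hanti : ∀ i, 1 ≤ i → i < M → a (i + 1) ≤ a i) (hM : 1 ≤ M) :
    (∑ i ∈ Icc 1 M, a i) ^ x ≤
      a 1 ^ x + (∑ k ∈ Icc 2 M, ((k : ℝ) ^ x - ((k : ℝ) - 1) ^ x) * a k ^ x) +
        x * ∑ p ∈ Icc 2 M, ((p : ℝ) - 1) ^ 2 / (p : ℝ) ^ 2 *
          (((∑ i ∈ Icc 1 (p - 1), a i) / a p) ^ (x - 1) - ((p : ℝ) - 1) ^ (x - 1)) * a p ^ x := by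
  induction M, hM using Nat.le_induction with
  | base => simp
  | succ n hn ih =>
    have ih' := ih (fun i h h' => hpos i h (by omega)) (fun i h h' => hanti i h (by omega))
    have hs := rpow_add_le_rpow_add_correction hx0 hx1 (Nat.cast_pos.2 hn : (0 : ℝ) < n)
      (hpos (n + 1) (by omega) le_rfl) (natCast_le_sum_div_of_antitone hpos hanti le_rfl)
    rw [sum_Icc_succ_top (by omega), sum_Icc_succ_top (by omega), sum_Icc_succ_top (by omega),
      mul_add]
    simp only [Nat.cast_add, Nat.cast_one, add_sub_cancel_right, Nat.add_sub_cancel]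
    linarith

/-- Comparison of the polygamy upper bounds displayed after Theorem 4.1 (and specialized in
Corollary 4.1): the correction-term bound is tighter than the coefficient bound with
`k^x − (k−1)^x`, which is tighter than the bounds with coefficients `2^x − 1`, `x` and `1`. -/
theorem polygamy_omega_bounds_comparison (δ ω x : ℝ) (hδ : 0 < δ) (hω0 : 0 ≤ ω)
    (hωδ : ω ≤ δ) (hx : x = ω / δ)
    (N : ℕ) (hN : 3 ≤ N) (E : ℝ) (Ei : ℕ → ℝ) (hE : 0 ≤ E)
    (hpos : ∀ i, 1 ≤ i → i ≤ N - 1 → 0 < Ei i)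
    (hdec : ∀ i, 1 ≤ i → i < N - 1 → Ei (i + 1) ≤ Ei i)
    (hpoly : E ^ δ ≤ ∑ i ∈ Icc 1 (N - 1), Ei i ^ δ) :
    (E ^ ω ≤
      Ei 1 ^ ω + (∑ k ∈ Icc 2 (N - 1), ((k : ℝ) ^ x - ((k : ℝ) - 1) ^ x) * Ei k ^ ω) +
        x * ∑ p ∈ Icc 2 (N - 1), ((p : ℝ) - 1) ^ 2 / (p : ℝ) ^ 2 *
          (((∑ i ∈ Icc 1 (p - 1), Ei i ^ δ) / Ei p ^ δ) ^ (x - 1) -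
              ((p : ℝ) - 1) ^ (x - 1)) * Ei p ^ ω) ∧
    (Ei 1 ^ ω + (∑ k ∈ Icc 2 (N - 1), ((k : ℝ) ^ x - ((k : ℝ) - 1) ^ x) * Ei k ^ ω) +
        x * ∑ p ∈ Icc 2 (N - 1), ((p : ℝ) - 1) ^ 2 / (p : ℝ) ^ 2 *
          (((∑ i ∈ Icc 1 (p - 1), Ei i ^ δ) / Ei p ^ δ) ^ (x - 1) -
              ((p : ℝ) - 1) ^ (x - 1)) * Ei p ^ ω ≤
      Ei 1 ^ ω + ∑ k ∈ Icc 2 (N - 1), ((k : ℝ) ^ x - ((k : ℝ) - 1) ^ x) * Ei k ^ ω) ∧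
    (Ei 1 ^ ω + (∑ k ∈ Icc 2 (N - 1), ((k : ℝ) ^ x - ((k : ℝ) - 1) ^ x) * Ei k ^ ω) ≤
      Ei 1 ^ ω + ∑ k ∈ Icc 2 (N - 1), ((2 : ℝ) ^ x - 1) * Ei k ^ ω) ∧
    (Ei 1 ^ ω + (∑ k ∈ Icc 2 (N - 1), ((2 : ℝ) ^ x - 1) * Ei k ^ ω) ≤
      Ei 1 ^ ω + ∑ k ∈ Icc 2 (N - 1), x * Ei k ^ ω) ∧
    (Ei 1 ^ ω + (∑ k ∈ Icc 2 (N - 1), x * Ei k ^ ω) ≤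
      ∑ k ∈ Icc 1 (N - 1), Ei k ^ ω) := by
  have hx0 : 0 ≤ x := hx ▸ div_nonneg hω0 hδ.le
  have hx1 : x ≤ 1 := hx ▸ (div_le_one hδ).2 hωδ
  have hδx : δ * x = ω := by rw [hx]; field_simp
  have hpow : ∀ y : ℝ, 0 ≤ y → (y ^ δ) ^ x = y ^ ω := fun y hy => by rw [← rpow_mul hy, hδx]
  have hpos2 : ∀ k ∈ Icc 2 (N - 1), 0 < Ei k := fun k hk => by
    rw [mem_Icc] at hk
    exact hpos k (by omega) hk.2
  have hposδ : ∀ i, 1 ≤ i → i ≤ N - 1 → 0 < Ei i ^ δ :=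
    fun i h h' => rpow_pos_of_pos (hpos i h h') δ
  have hantiδ : ∀ i, 1 ≤ i → i < N - 1 → Ei (i + 1) ^ δ ≤ Ei i ^ δ := fun i h h' =>
    rpow_le_rpow (hpos (i + 1) (by omega) (by omega)).le (hdec i h h') hδ.le
  have h2x : (2 : ℝ) ^ x - 1 ≤ x := by
    have h := rpow_one_add_le_one_add_mul_self (s := 1) (by norm_num) hx0 hx1
    norm_num at h
    linarith
  refine ⟨?_, ?_, ?_, ?_, ?_⟩
  · have h := sum_rpow_le_sum_correction hx0 hx1 hposδ hantiδ (by omega)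
    rw [← hpow E hE]
    refine (rpow_le_rpow (rpow_nonneg hE δ) hpoly hx0).trans (h.trans (le_of_eq ?_))
    rw [hpow _ (hpos 1 le_rfl (by omega)).le]
    congr 2
    · exact sum_congr rfl fun k hk => by rw [hpow _ (hpos2 k hk).le]
    · exact sum_congr rfl fun k hk => by rw [hpow _ (hpos2 k hk).le]
  · refine add_le_of_nonpos_right (mul_nonpos_of_nonneg_of_nonpos hx0 (sum_nonpos ?_))
    intro p hp
    refine mul_nonpos_of_nonpos_of_nonneg (mul_nonpos_of_nonneg_of_nonpos (by positivity) ?_)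
      (rpow_nonneg (hpos2 p hp).le ω)
    rw [mem_Icc] at hp
    obtain ⟨n, rfl⟩ : ∃ n, p = n + 1 := ⟨p - 1, by omega⟩
    have hn : (0 : ℝ) < n := Nat.cast_pos.2 (by omega)
    simp only [Nat.cast_add, Nat.cast_one, add_sub_cancel_right, Nat.add_sub_cancel, sub_nonpos]
    exact rpow_le_rpow_of_nonpos hn (natCast_le_sum_div_of_antitone hposδ hantiδ hp.2)
      (by linarith)
  · refine add_le_add_right (sum_le_sum fun k hk => ?_) _
    exact mul_le_mul_of_nonneg_right
      (rpow_sub_rpow_sub_one_le hx0 hx1 (by exact_mod_cast (mem_Icc.1 hk).1))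
      (rpow_nonneg (hpos2 k hk).le ω)
  · gcongr with k hk
    exact rpow_nonneg (hpos2 k hk).le ω
  · rw [← add_sum_Ioc_eq_sum_Icc (show 1 ≤ N - 1 by omega)]
    change _ ≤ Ei 1 ^ ω + ∑ k ∈ Icc 2 (N - 1), Ei k ^ ω
    gcongr with k hk
    exact mul_le_of_le_one_left (rpow_nonneg (hpos2 k hk).le ω) hx1
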